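/- Let λ be the Lyapunov exponent of the i.i.d. random product of A and B. Then Σ_{a,b=1}^∞ 2^{−a−b} log( (1/3)(φ̂₁⁽¹⁾(a,b) + φ̂₁⁽²⁾(a,b) + φ̂₁⁽³⁾(a,b)) ) ≤ 4λ ≤ Σ_{a,b=1}^∞ 2^{−a−b} log( (1/3)(ψ̂_∞⁽¹⁾(a,b) + ψ̂_∞⁽²⁾(a,b) + ψ̂_∞⁽³⁾(a,b)) ), where φ̂₁⁽¹⁾(a,b) = 1 + (α/(1+α))(a + bβ + aαbβ), φ̂₁⁽²⁾(a,b) = [α(αβ+2)(aαbβ + bβ + 1) + (aα+1)(αβ+1)] / [α(αβ+β+2) + 1], φ̂₁⁽³⁾(a,b) = [α(2αβ+3)(aαbβ + bβ + 1) + (aα+1)(αβ+1)] / [α(2αβ+β+3) + 1], ψ̂_∞⁽¹⁾(a,b) = 1 + a + aαbβ, ψ̂_∞⁽²⁾(a,b) = 1 + aαbβ + a(1+αβ)/(2+αβ), and ψ̂_∞⁽³⁾(a,b) = 1 + aαbβ + a(1+αβ)/(3+2αβ). -/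

import Mathlib

open Filter

noncomputable section

/-- `M_i = A_{i_N} ⋯ A_{i_1}`, where index value `0` selects `A` and `1` selects `B`. -/
def wordProd (A B : Matrix (Fin 2) (Fin 2) ℝ) (N : ℕ) (i : Fin N → Fin 2) :
    Matrix (Fin 2) (Fin 2) ℝ :=
  ((List.ofFn fun k => if i k = 0 then A else B).reverse).prod

/-- The Euclidean norm on ℝ². -/
def nrm2 (x : Fin 2 → ℝ) : ℝ := Real.sqrt ((x 0) ^ 2 + (x 1) ^ 2)


def phihat11 (α β : ℝ) (a b : ℕ) : ℝ := 1 + α / (1 + α) * (a + b * β + a * α * (b * β))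

def phihat12 (α β : ℝ) (a b : ℕ) : ℝ :=
  (α * (α * β + 2) * (a * α * (b * β) + b * β + 1) + (a * α + 1) * (α * β + 1)) /
    (α * (α * β + β + 2) + 1)

def phihat13 (α β : ℝ) (a b : ℕ) : ℝ :=
  (α * (2 * (α * β) + 3) * (a * α * (b * β) + b * β + 1) + (a * α + 1) * (α * β + 1)) /
    (α * (2 * (α * β) + β + 3) + 1)

def psihatInf1 (α β : ℝ) (a b : ℕ) : ℝ := 1 + a + a * α * (b * β)

def psihatInf2 (α β : ℝ) (a b : ℕ) : ℝ :=
  1 + a * α * (b * β) + a * (1 + α * β) / (2 + α * β)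

def psihatInf3 (α β : ℝ) (a b : ℕ) : ℝ :=
  1 + a * α * (b * β) + a * (1 + α * β) / (3 + 2 * (α * β))

/-- Linear growth. -/
def Adm (f : ℕ → ℝ) : Prop := ∃ K : ℝ, ∀ k, |f k| ≤ K * (1 + k)

/-- Average against the geometric law. -/
def geoS (f : ℕ → ℝ) : ℝ := ∑' k : ℕ, ((2 : ℝ) ^ (k + 1))⁻¹ * f k

lemma summable_base : Summable (fun k : ℕ => ((2 : ℝ) ^ (k + 1))⁻¹ * (1 + (k:ℝ))) := by
  have h1 : Summable (fun k : ℕ => ((k:ℝ) ^ 1 * (1/2 : ℝ) ^ k)) :=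
    summable_pow_mul_geometric_of_norm_lt_one 1 (by norm_num)
  have h2 : Summable (fun k : ℕ => ((1/2 : ℝ) ^ k)) :=
    summable_geometric_of_lt_one (by norm_num) (by norm_num)
  refine ((h1.add h2).mul_left (1/2)).congr fun k => ?_
  rw [pow_succ 2 k, mul_inv, ← inv_pow, one_div]
  ring

lemma Adm.summable {f : ℕ → ℝ} (hf : Adm f) :
    Summable (fun k : ℕ => ((2 : ℝ) ^ (k + 1))⁻¹ * f k) := by
  obtain ⟨K, hK⟩ := hf
  refine Summable.of_norm_bounded (summable_base.mul_left K) fun k => ?_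
  rw [Real.norm_eq_abs, abs_mul, abs_of_pos (by positivity : (0:ℝ) < ((2 : ℝ) ^ (k + 1))⁻¹)]
  have := mul_le_mul_of_nonneg_left (hK k) (by positivity : (0:ℝ) ≤ ((2 : ℝ) ^ (k + 1))⁻¹)
  linarith

lemma Adm.const (c : ℝ) : Adm (fun _ => c) :=
  ⟨|c|, fun k => by have := abs_nonneg c; have : (0:ℝ) ≤ k := by positivity
                    nlinarith⟩

lemma Adm.id : Adm (fun k => (k:ℝ)) :=
  ⟨1, fun k => by have : (0:ℝ) ≤ k := by positivity
                  rw [abs_of_nonneg this]; linarith⟩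

lemma Adm.add {f g : ℕ → ℝ} (hf : Adm f) (hg : Adm g) : Adm (fun k => f k + g k) := by
  obtain ⟨K, hK⟩ := hf
  obtain ⟨K', hK'⟩ := hg
  refine ⟨K + K', fun k => ?_⟩
  have := abs_add_le (f k) (g k)
  have := hK k
  have := hK' k
  linarith

lemma Adm.smul {f : ℕ → ℝ} (c : ℝ) (hf : Adm f) : Adm (fun k => c * f k) := by
  obtain ⟨K, hK⟩ := hf
  refine ⟨|c| * K, fun k => ?_⟩
  rw [abs_mul, mul_assoc]
  exact mul_le_mul_of_nonneg_left (hK k) (abs_nonneg c)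

lemma Adm.sub {f g : ℕ → ℝ} (hf : Adm f) (hg : Adm g) : Adm (fun k => f k - g k) := by
  have := hf.add (hg.smul (-1))
  refine (show (fun k => f k - g k) = fun k => f k + (-1) * g k by funext k; ring) ▸ this

lemma Adm.succ {f : ℕ → ℝ} (hf : Adm f) : Adm (fun k => f (k+1)) := by
  obtain ⟨K, hK⟩ := hf
  have hK0 : 0 ≤ K := by have := (abs_nonneg _).trans (hK 0); simpa using this
  refine ⟨2 * K, fun k => (hK (k+1)).trans ?_⟩
  push_cast
  have : (0:ℝ) ≤ k := by positivity
  nlinarith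

lemma Adm.mk' {f : ℕ → ℝ} (c d : ℝ) (h : ∀ k, |f k| ≤ c + d * k) : Adm f := by
  refine ⟨|c| + |d|, fun k => (h k).trans ?_⟩
  have : (0:ℝ) ≤ k := by positivity
  have := le_abs_self c
  have := le_abs_self d
  have := abs_nonneg c
  have := abs_nonneg d
  nlinarith

lemma geoS_add {f g : ℕ → ℝ} (hf : Adm f) (hg : Adm g) :
    geoS (fun k => f k + g k) = geoS f + geoS g := by
  unfold geoS
  rw [← hf.summable.tsum_add hg.summable]
  congr 1; funext k; ring

lemma geoS_smul (c : ℝ) (f : ℕ → ℝ) :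
    geoS (fun k => c * f k) = c * geoS f := by
  unfold geoS
  rw [← tsum_mul_left]
  congr 1; funext k; ring

lemma geoS_sub {f g : ℕ → ℝ} (hf : Adm f) (hg : Adm g) :
    geoS (fun k => f k - g k) = geoS f - geoS g := by
  have := geoS_add hf (hg.smul (-1))
  rw [geoS_smul] at this
  rw [show (fun k => f k - g k) = fun k => f k + (-1) * g k by funext k; ring, this]
  ring

lemma geoS_mono {f g : ℕ → ℝ} (hf : Adm f) (hg : Adm g) (h : ∀ k, f k ≤ g k) :
    geoS f ≤ geoS g :=
  hf.summable.tsum_le_tsum (fun k => mul_le_mul_of_nonneg_left (h k) (by positivity)) hg.summable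

lemma geoS_succ {f : ℕ → ℝ} (hf : Adm f) :
    geoS f = 1/2 * f 0 + 1/2 * geoS (fun k => f (k+1)) := by
  unfold geoS
  rw [hf.summable.tsum_eq_zero_add, ← tsum_mul_left]
  congr 1
  · norm_num
  · congr 1; funext k
    rw [pow_succ _ (k+1), mul_inv]; ring

lemma geoS_const (c : ℝ) : geoS (fun _ => c) = c := by
  have := geoS_succ (Adm.const c)
  linarith

lemma geoS_id : geoS (fun k => (k:ℝ)) = 1 := by
  have := geoS_succ Adm.id
  have h2 := geoS_add Adm.id (Adm.const 1)
  rw [geoS_const] at h2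
  push_cast at this
  linarith

lemma geoS_abs_le {f : ℕ → ℝ} {c d : ℝ} (h : ∀ k, |f k| ≤ c + d * k) : |geoS f| ≤ c + d := by
  have hf := Adm.mk' c d h
  have hg : Adm (fun k => c + d * (k:ℝ)) := (Adm.const c).add (Adm.id.smul d)
  have e : geoS (fun k => c + d * (k:ℝ)) = c + d := by
    rw [geoS_add (Adm.const c) (Adm.id.smul d), geoS_const, geoS_smul, geoS_id]; ring
  have e' : geoS (fun k => (-1) * (c + d * (k:ℝ))) = -(c + d) := by
    rw [geoS_smul, e]; ring
  rw [abs_le]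
  constructor
  · rw [← e']
    exact geoS_mono (hg.smul (-1)) hf fun k => by have := (abs_le.1 (h k)).1; linarith
  · rw [← e]
    exact geoS_mono hf hg fun k => (abs_le.1 (h k)).2

lemma geoS_comm {f : ℕ → ℕ → ℝ} {c d e : ℝ} (hc : 0 ≤ c) (hd : 0 ≤ d) (he : 0 ≤ e)
    (h : ∀ a b : ℕ, |f a b| ≤ c + d * a + e * b) :
    geoS (fun a => geoS (fun b => f a b)) = geoS (fun b => geoS (fun a => f a b)) := by
  unfold geoS
  simp_rw [← tsum_mul_left]
  rw [Summable.tsum_comm]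
  · congr 1; funext b; congr 1; funext a; ring
  · have hs := summable_base.mul_of_nonneg summable_base (fun k => by positivity)
      (fun k => by positivity)
    refine Summable.of_norm_bounded (hs.mul_left (c + d + e)) fun ⟨b, a⟩ => ?_
    simp only [Function.uncurry]
    rw [Real.norm_eq_abs, abs_mul, abs_mul,
      abs_of_pos (by positivity : (0:ℝ) < ((2 : ℝ) ^ (a + 1))⁻¹),
      abs_of_pos (by positivity : (0:ℝ) < ((2 : ℝ) ^ (b + 1))⁻¹)]
    have h1 : |f a b| ≤ (c + d + e) * ((1 + a) * (1 + b)) := by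
      refine (h a b).trans ?_
      have ha : (0:ℝ) ≤ a := by positivity
      have hb : (0:ℝ) ≤ b := by positivity
      have : (0:ℝ) ≤ a * b := by positivity
      nlinarith [mul_nonneg hc ha, mul_nonneg hc hb, mul_nonneg hd ha, mul_nonneg he hb, mul_nonneg hd hb, mul_nonneg he ha, mul_nonneg hc this, mul_nonneg hd this, mul_nonneg he this]
    have := mul_le_mul_of_nonneg_left h1
      (by positivity : (0:ℝ) ≤ ((2 : ℝ) ^ (a + 1))⁻¹ * ((2 : ℝ) ^ (b + 1))⁻¹)
    linarith

lemma geoS_stmt (f : ℕ → ℕ → ℝ) :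
    (∑' (a : ℕ) (b : ℕ), ((2 : ℝ) ^ (a + b + 2))⁻¹ * f a b) =
      geoS (fun a => geoS (fun b => f a b)) := by
  unfold geoS
  simp_rw [← tsum_mul_left]
  congr 1; funext a; congr 1; funext b
  rw [← mul_assoc, ← mul_inv, ← pow_add]
  congr 3; ring

/-- The averaged log-norm after `N` steps, started at `(u,v)`. -/
def lavg (α β : ℝ) (N : ℕ) (u v : ℝ) : ℝ :=
  ((2 : ℝ) ^ N)⁻¹ * ∑ i : Fin N → Fin 2,
    Real.log (nrm2 ((wordProd !![1, 0; α, 1] !![1, β; 0, 1] N i).mulVec ![u, v]))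

lemma wordProd_cons (A B : Matrix (Fin 2) (Fin 2) ℝ) (N : ℕ) (x : Fin 2) (i : Fin N → Fin 2) :
    wordProd A B (N+1) (Fin.cons x i) = wordProd A B N i * (if x = 0 then A else B) := by
  unfold wordProd
  rw [List.ofFn_succ]
  simp

lemma lavg_zero (α β u v : ℝ) : lavg α β 0 u v = Real.log (nrm2 ![u, v]) := by
  simp [lavg, wordProd]

lemma lavg_succ (α β : ℝ) (N : ℕ) (u v : ℝ) :
    lavg α β (N+1) u v = 1/2 * lavg α β N u (v + α * u) + 1/2 * lavg α β N (u + β * v) v := by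
  unfold lavg
  rw [← (Fin.consEquiv (fun _ : Fin (N+1) => Fin 2)).sum_comp, Fintype.sum_prod_type]
  simp only [Fin.consEquiv, Equiv.coe_fn_mk, Fin.sum_univ_two]
  have h1 : ∀ i : Fin N → Fin 2,
      (wordProd !![1, 0; α, 1] !![1, β; 0, 1] (N+1) (Fin.cons 0 i)).mulVec ![u, v] =
      (wordProd !![1, 0; α, 1] !![1, β; 0, 1] N i).mulVec ![u, v + α * u] := by
    intro i
    rw [wordProd_cons, ← Matrix.mulVec_mulVec]
    congr 1
    ext j; fin_cases j <;> simp [Matrix.mulVec, dotProduct, Fin.sum_univ_two]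
    ring
  have h2 : ∀ i : Fin N → Fin 2,
      (wordProd !![1, 0; α, 1] !![1, β; 0, 1] (N+1) (Fin.cons 1 i)).mulVec ![u, v] =
      (wordProd !![1, 0; α, 1] !![1, β; 0, 1] N i).mulVec ![u + β * v, v] := by
    intro i
    rw [wordProd_cons, ← Matrix.mulVec_mulVec]
    congr 1
    ext j; fin_cases j <;> simp [Matrix.mulVec, dotProduct, Fin.sum_univ_two]
  simp only [h1, h2]
  rw [pow_succ, mul_inv]
  ring

lemma log_nrm2_close {u v : ℝ} (hu : 0 ≤ u) (hv : 0 < v) :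
    |Real.log (nrm2 ![u, v]) - Real.log (u + v)| ≤ Real.log 2 := by
  have h0 : nrm2 ![u, v] = Real.sqrt (u ^ 2 + v ^ 2) := by simp [nrm2]
  have hp : 0 < Real.sqrt (u ^ 2 + v ^ 2) := Real.sqrt_pos.2 (by positivity)
  have h1 : Real.sqrt (u ^ 2 + v ^ 2) ≤ u + v := by
    apply Real.sqrt_le_iff.2
    constructor
    · positivity
    · nlinarith [mul_nonneg hu hv.le]
  have h2 : u + v ≤ 2 * Real.sqrt (u ^ 2 + v ^ 2) := by
    have : u ≤ Real.sqrt (u ^ 2 + v ^ 2) := Real.le_sqrt_of_sq_le (by nlinarith)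
    have : v ≤ Real.sqrt (u ^ 2 + v ^ 2) := Real.le_sqrt_of_sq_le (by nlinarith)
    linarith
  have h3 := Real.log_le_log hp h1
  have h4 := Real.log_le_log (by positivity) h2
  rw [Real.log_mul (by norm_num) hp.ne'] at h4
  have := Real.log_nonneg (by norm_num : (1:ℝ) ≤ 2)
  rw [h0, abs_le]
  constructor <;> linarith

lemma log_A_close {α u v : ℝ} (hα : 0 ≤ α) (hu : 0 ≤ u) (hv : 0 < v) (k : ℝ) (hk : 0 ≤ k) :
    |Real.log (u + (v + k * α * u)) - Real.log (u + v)| ≤ α * k := by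
  have h1 : u + v ≤ u + (v + k * α * u) := by have : 0 ≤ k * α * u := by positivity
                                              linarith
  have h2 : u + (v + k * α * u) ≤ (u + v) * (1 + α * k) := by
    have : 0 ≤ k * α * v := by positivity
    nlinarith
  have hp : 0 < u + v := by positivity
  have hq : 0 < 1 + α * k := by positivity
  have h3 := Real.log_le_log hp h1
  have h4 := Real.log_le_log (by linarith) h2
  rw [Real.log_mul hp.ne' hq.ne'] at h4
  have h5 := Real.log_le_sub_one_of_pos hq
  rw [abs_le]
  have : 0 ≤ α * k := by positivity
  constructor <;> linarith

lemma log_B_close {β u v : ℝ} (hβ : 0 ≤ β) (hu : 0 ≤ u) (hv : 0 < v) (k : ℝ) (hk : 0 ≤ k) :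
    |Real.log (u + k * β * v + v) - Real.log (u + v)| ≤ β * k := by
  have h1 : u + v ≤ u + k * β * v + v := by have : 0 ≤ k * β * v := by positivity
                                            linarith
  have h2 : u + k * β * v + v ≤ (u + v) * (1 + β * k) := by
    have : 0 ≤ k * β * u := by positivity
    nlinarith
  have hp : 0 < u + v := by positivity
  have hq : 0 < 1 + β * k := by positivity
  have h3 := Real.log_le_log hp h1
  have h4 := Real.log_le_log (by linarith) h2
  rw [Real.log_mul hp.ne' hq.ne'] at h4
  have h5 := Real.log_le_sub_one_of_pos hq
  rw [abs_le]
  have : 0 ≤ β * k := by positivity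
  constructor <;> linarith

/-- The cone of vectors whose last letter was `A`. -/
def ConeA (α u v : ℝ) : Prop := 0 ≤ u ∧ 0 < v ∧ α * u ≤ v

/-- A functional that agrees with `σ log (u+v)` up to a bounded error on the cone. -/
def Close (α σ C : ℝ) (g : ℝ → ℝ → ℝ) : Prop :=
  ∀ u v, ConeA α u v → |g u v - σ * Real.log (u + v)| ≤ C

lemma coneA_A {α u v : ℝ} (hα : 0 ≤ α) (h : ConeA α u v) (k : ℕ) : ConeA α u (v + k * α * u) := by
  obtain ⟨hu, hv, h⟩ := h
  have : 0 ≤ k * α * u := by positivity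
  exact ⟨hu, by linarith, by linarith⟩

lemma coneA_AB {α β u v : ℝ} (hα : 0 ≤ α) (hβ : 0 ≤ β) (hu : 0 ≤ u) (hv : 0 < v) (k j : ℕ) :
    ConeA α (u + k * β * v) (v + (j + 1) * α * (u + k * β * v)) := by
  have h1 : 0 ≤ u + k * β * v := by positivity
  have : 0 ≤ (j:ℝ) * α * (u + k * β * v) := by positivity
  have : 0 ≤ α * (u + k * β * v) := by positivity
  exact ⟨h1, by linarith, by linarith⟩

lemma Close.abs_A {α σ C : ℝ} {g : ℝ → ℝ → ℝ} (hα : 0 ≤ α) (hg : Close α σ C g) {u v : ℝ}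
    (h : ConeA α u v) (k : ℕ) :
    |g u (v + k * α * u) - σ * Real.log (u + v)| ≤ C + |σ| * α * k := by
  have h1 := hg _ _ (coneA_A hα h k)
  have h2 := log_A_close hα h.1 h.2.1 k (by positivity)
  have h3 := mul_le_mul_of_nonneg_left h2 (abs_nonneg σ)
  rw [← abs_mul] at h3
  have := abs_add_le (g u (v + k * α * u) - σ * Real.log (u + (v + k * α * u)))
    (σ * (Real.log (u + (v + k * α * u)) - Real.log (u + v)))
  rw [show g u (v + k * α * u) - σ * Real.log (u + v) =
    g u (v + k * α * u) - σ * Real.log (u + (v + k * α * u)) +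
    (σ * (Real.log (u + (v + k * α * u)) - Real.log (u + v))) by ring]
  linarith

lemma Close.abs_AB {α β σ C : ℝ} {g : ℝ → ℝ → ℝ} (hα : 0 ≤ α) (hβ : 0 ≤ β) (hg : Close α σ C g)
    {u v : ℝ} (hu : 0 ≤ u) (hv : 0 < v) (k j : ℕ) :
    |g (u + k * β * v) (v + (j + 1) * α * (u + k * β * v)) - σ * Real.log (u + v)| ≤
      C + |σ| * β * k + |σ| * α * (j + 1) := by
  have h1 := hg _ _ (coneA_AB hα hβ hu hv k j)
  have h2 := log_B_close hβ hu hv k (by positivity)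
  have h3 := log_A_close hα (by positivity : 0 ≤ u + k * β * v) hv (j + 1) (by positivity)
  have h4 := mul_le_mul_of_nonneg_left h2 (abs_nonneg σ)
  rw [← abs_mul] at h4
  have h5 := mul_le_mul_of_nonneg_left h3 (abs_nonneg σ)
  rw [← abs_mul] at h5
  set G := g (u + k * β * v) (v + (j + 1) * α * (u + k * β * v))
  set l1 := Real.log (u + k * β * v + (v + (j + 1) * α * (u + k * β * v)))
  set l2 := Real.log (u + k * β * v + v)
  set l3 := Real.log (u + v)
  have := abs_add_three (G - σ * l1) (σ * (l1 - l2)) (σ * (l2 - l3))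
  rw [show G - σ * l3 = G - σ * l1 + σ * (l1 - l2) + σ * (l2 - l3) by ring]
  linarith

lemma adm_of_close {f : ℕ → ℝ} (x c d : ℝ) (h : ∀ k, |f k - x| ≤ c + d * k) : Adm f := by
  refine Adm.mk' (c + |x|) d fun k => ?_
  have := abs_add_le (f k - x) x
  rw [sub_add_cancel] at this
  have := h k
  linarith

lemma geoS_close {f : ℕ → ℝ} {x c d : ℝ} (h : ∀ k, |f k - x| ≤ c + d * k) :
    |geoS f - x| ≤ c + d := by
  have := geoS_abs_le h
  rwa [geoS_sub (adm_of_close x c d h) (Adm.const x), geoS_const] at this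

/-- Expectation over one block `A^a B^b`. -/
def blockE (α β : ℝ) (g : ℝ → ℝ → ℝ) (u v : ℝ) : ℝ :=
  geoS fun b => geoS fun a =>
    g (u + (b + 1 : ℕ) * β * v) (v + (a + 1) * α * (u + (b + 1 : ℕ) * β * v))

lemma Close.adm_A {α σ C : ℝ} {g : ℝ → ℝ → ℝ} (hα : 0 ≤ α) (hg : Close α σ C g) {u v : ℝ}
    (h : ConeA α u v) : Adm fun k => g u (v + k * α * u) :=
  adm_of_close _ _ _ (hg.abs_A hα h)

lemma Close.close_AB {α β σ C : ℝ} {g : ℝ → ℝ → ℝ} (hα : 0 ≤ α) (hβ : 0 ≤ β) (hg : Close α σ C g)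
    {u v : ℝ} (hu : 0 ≤ u) (hv : 0 < v) (k : ℕ) :
    ∀ j : ℕ, |g (u + k * β * v) (v + (j + 1) * α * (u + k * β * v)) - σ * Real.log (u + v)| ≤
      (C + |σ| * α + |σ| * β * k) + |σ| * α * j := by
  intro j
  have := hg.abs_AB hα hβ hu hv k j
  linarith

lemma Close.adm_AB {α β σ C : ℝ} {g : ℝ → ℝ → ℝ} (hα : 0 ≤ α) (hβ : 0 ≤ β) (hg : Close α σ C g)
    {u v : ℝ} (hu : 0 ≤ u) (hv : 0 < v) (k : ℕ) :
    Adm fun j : ℕ => g (u + k * β * v) (v + (j + 1) * α * (u + k * β * v)) :=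
  adm_of_close _ _ _ (hg.close_AB hα hβ hu hv k)

lemma Close.close_AB2 {α β σ C : ℝ} {g : ℝ → ℝ → ℝ} (hα : 0 ≤ α) (hβ : 0 ≤ β) (hg : Close α σ C g)
    {u v : ℝ} (hu : 0 ≤ u) (hv : 0 < v) (k : ℕ) :
    |(geoS fun j : ℕ => g (u + k * β * v) (v + (j + 1) * α * (u + k * β * v)))
      - σ * Real.log (u + v)| ≤ (C + 2 * |σ| * α) + |σ| * β * k := by
  have := geoS_close (hg.close_AB hα hβ hu hv k)
  linarith

lemma Close.adm_AB2 {α β σ C : ℝ} {g : ℝ → ℝ → ℝ} (hα : 0 ≤ α) (hβ : 0 ≤ β) (hg : Close α σ C g)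
    {u v : ℝ} (hu : 0 ≤ u) (hv : 0 < v) :
    Adm fun k : ℕ => geoS fun j : ℕ => g (u + k * β * v) (v + (j + 1) * α * (u + k * β * v)) :=
  adm_of_close _ _ _ (hg.close_AB2 hα hβ hu hv)

lemma Close.blockE {α β σ C : ℝ} {g : ℝ → ℝ → ℝ} (hα : 0 ≤ α) (hβ : 0 ≤ β) (hg : Close α σ C g) :
    Close α σ (C + 2 * |σ| * α + 2 * |σ| * β) (blockE α β g) := by
  intro u v h
  have h1 : ∀ k : ℕ, |(geoS fun j : ℕ => g (u + (k+1:ℕ) * β * v)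
      (v + (j + 1) * α * (u + (k+1:ℕ) * β * v)))
      - σ * Real.log (u + v)| ≤ (C + 2 * |σ| * α + |σ| * β) + |σ| * β * k := by
    intro k
    have := hg.close_AB2 hα hβ h.1 h.2.1 (k+1)
    push_cast at this ⊢
    linarith
  have := geoS_close h1
  unfold _root_.blockE
  linarith

section dyn
variable {α β σ C L : ℝ} {D : ℝ → ℝ → ℝ}

/-- Potential when the last letter was `A`. -/
def WA (α L : ℝ) (D : ℝ → ℝ → ℝ) (u v : ℝ) : ℝ :=
  (geoS fun k => D u (v + k * α * u)) - L / 4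

/-- Potential when the last letter was `B`. -/
def WB (α β L : ℝ) (D : ℝ → ℝ → ℝ) (u v : ℝ) : ℝ :=
  (geoS fun k => geoS fun j : ℕ => D (u + k * β * v) (v + (j + 1) * α * (u + k * β * v))) - 3 * (L / 4)

lemma WA_step (hα : 0 ≤ α) (hD : Close α σ C D) {u v : ℝ} (h : ConeA α u v) :
    WA α L D u v = 1/2 * D u v + 1/2 * (WA α L D u (v + α * u) - L / 4) := by
  unfold WA
  rw [geoS_succ (hD.adm_A hα h)]
  have : (fun k : ℕ => D u (v + ((k + 1 : ℕ):ℝ) * α * u)) = fun k : ℕ => D u (v + α * u + k * α * u) := by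
    funext k; congr 1; push_cast; ring
  rw [this]
  simp only [Nat.cast_zero, zero_mul, add_zero]
  ring

lemma WB_step (hα : 0 ≤ α) (hβ : 0 ≤ β) (hD : Close α σ C D) {u v : ℝ} (hu : 0 ≤ u) (hv : 0 < v) :
    WB α β L D u v = 1/2 * (WA α L D u (v + α * u) - L / 4) +
      1/2 * (WB α β L D (u + β * v) v - L / 4) := by
  unfold WA WB
  rw [geoS_succ (hD.adm_AB2 hα hβ hu hv)]
  have h1 : (fun k : ℕ => geoS fun j : ℕ => D (u + ((k + 1 : ℕ):ℝ) * β * v)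
      (v + (j + 1) * α * (u + ((k + 1 : ℕ):ℝ) * β * v))) =
      fun k : ℕ => geoS fun j : ℕ => D (u + β * v + k * β * v)
      (v + (j + 1) * α * (u + β * v + k * β * v)) := by
    funext k; congr 1; funext j; congr 1 <;> (push_cast; ring)
  have h2 : (fun j : ℕ => D (u + ((0 : ℕ):ℝ) * β * v) (v + (j + 1) * α * (u + ((0:ℕ):ℝ) * β * v)))
      = fun k : ℕ => D u (v + α * u + k * α * u) := by
    funext k; congr 1 <;> (push_cast; ring)
  rw [h1, h2]
  ring

lemma D_le_WB (hα : 0 ≤ α) (hβ : 0 ≤ β)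
    (hL : ∀ u v, ConeA α u v → D u v + L ≤ blockE α β D u v) {u v : ℝ} (h : ConeA α u v) :
    D u v ≤ WB α β L D (u + β * v) v - L / 4 := by
  have := hL u v h
  unfold WB
  have h1 : (fun k : ℕ => geoS fun j : ℕ => D (u + ((k + 1 : ℕ):ℝ) * β * v)
      (v + (j + 1) * α * (u + ((k + 1 : ℕ):ℝ) * β * v))) =
      fun k : ℕ => geoS fun j : ℕ => D (u + β * v + k * β * v)
      (v + (j + 1) * α * (u + β * v + k * β * v)) := by
    funext k; congr 1; funext j; congr 1 <;> (push_cast; ring)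
  unfold blockE at this
  rw [h1] at this
  linarith

lemma dyn_bound (hα : 0 ≤ α) (hβ : 0 ≤ β) (hD : Close α σ C D)
    (hL : ∀ u v, ConeA α u v → D u v + L ≤ blockE α β D u v) :
    ∃ K : ℝ, ∀ N : ℕ,
      (∀ u v, ConeA α u v → WA α L D u v + N * (L / 4) ≤ σ * lavg α β N u v + K) ∧
      (∀ u v, 0 ≤ u → 0 < v → WB α β L D u v + N * (L / 4) ≤ σ * lavg α β N u v + K) := by
  refine ⟨C + 2 * |σ| * α + |σ| * β + |σ| * Real.log 2 + |L|, fun N => ?_⟩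
  induction N with
  | zero =>
    have key : ∀ u v : ℝ, 0 ≤ u → 0 < v → σ * Real.log (u + v) ≤
        σ * lavg α β 0 u v + |σ| * Real.log 2 := by
      intro u v hu hv
      rw [lavg_zero]
      have h1 := mul_le_mul_of_nonneg_left (log_nrm2_close hu hv) (abs_nonneg σ)
      rw [← abs_mul] at h1
      have := (abs_le.1 h1).1
      linarith
    have hL1 : -|L| ≤ L := neg_abs_le L
    have hL2 : 0 ≤ |L| := abs_nonneg L
    have hs1 : 0 ≤ |σ| * α := by positivity
    have hs2 : 0 ≤ |σ| * β := by positivity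
    constructor
    · intro u v h
      have h1 := (abs_le.1 (geoS_close (hD.abs_A hα h))).2
      have h2 := key u v h.1 h.2.1
      unfold WA
      push_cast
      linarith
    · intro u v hu hv
      have h1 := (abs_le.1 (geoS_close (hD.close_AB2 hα hβ hu hv))).2
      have h2 := key u v hu hv
      unfold WB
      push_cast
      linarith
  | succ N ih =>
    obtain ⟨ihA, ihB⟩ := ih
    constructor
    · intro u v h
      have e := WA_step (L := L) hα hD h
      have e2 := D_le_WB hα hβ hL h
      have hu := h.1
      have hv := h.2.1
      have e3 := ihA u (v + α * u) (by simpa using coneA_A hα h 1)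
      have e4 := ihB (u + β * v) v (by positivity) hv
      rw [lavg_succ]
      push_cast
      linarith
    · intro u v hu hv
      have e := WB_step (L := L) hα hβ hD hu hv
      have e3 := ihA u (v + α * u) (by simpa using coneA_AB hα le_rfl hu hv 0 0 (β := 0))
      have e4 := ihB (u + β * v) v (by positivity) hv
      rw [lavg_succ]
      push_cast
      linarith

lemma dyn_limit {lam : ℝ} (hα : 0 ≤ α) (hβ : 0 ≤ β) (hD : Close α σ C D)
    (hL : ∀ u v, ConeA α u v → D u v + L ≤ blockE α β D u v)
    (hlam : Tendsto (fun N : ℕ => ((N : ℝ))⁻¹ * lavg α β N 0 1) atTop (nhds lam)) :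
    L ≤ 4 * (σ * lam) := by
  obtain ⟨K, hK⟩ := dyn_bound hα hβ hD hL
  have h0 : ConeA α 0 1 := ⟨le_rfl, one_pos, by simp⟩
  have ht : Tendsto (fun N : ℕ => (N:ℝ)⁻¹ * (WA α L D 0 1 - K) + L / 4) atTop
      (nhds (0 * (WA α L D 0 1 - K) + L / 4)) :=
    ((tendsto_inv_atTop_nhds_zero_nat (𝕜 := ℝ)).mul_const _).add_const _
  have := le_of_tendsto_of_tendsto ht (hlam.const_mul σ) (by
    filter_upwards [eventually_gt_atTop 0] with N hN
    have hN' : (0:ℝ) < N := by exact_mod_cast hN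
    have h1 := (hK N).1 0 1 h0
    have h2 := mul_le_mul_of_nonneg_left h1 (inv_nonneg.2 hN'.le)
    have h3 : (N:ℝ)⁻¹ * (N * (L/4)) = L / 4 := by field_simp
    linarith)
  linarith
end dyn

lemma blockE_add {α β σ C τ K : ℝ} {g q : ℝ → ℝ → ℝ} (hα : 0 ≤ α) (hβ : 0 ≤ β)
    (hg : Close α σ C g) (hq : Close α τ K q) {u v : ℝ} (hu : 0 ≤ u) (hv : 0 < v) :
    blockE α β (fun u v => g u v + q u v) u v = blockE α β g u v + blockE α β q u v := by
  unfold blockE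
  rw [← geoS_add (hg.adm_AB2 hα hβ hu hv).succ (hq.adm_AB2 hα hβ hu hv).succ]
  congr 1; funext k
  rw [← geoS_add (hg.adm_AB hα hβ hu hv (k+1)) (hq.adm_AB hα hβ hu hv (k+1))]

lemma blockE_congr {α β : ℝ} {g q : ℝ → ℝ → ℝ} (hα : 0 ≤ α) (hβ : 0 ≤ β)
    (h : ∀ u v, ConeA α u v → g u v = q u v) {u v : ℝ} (hu : 0 ≤ u) (hv : 0 < v) :
    blockE α β g u v = blockE α β q u v := by
  unfold blockE
  congr 1; funext k; congr 1; funext j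
  exact h _ _ (coneA_AB hα hβ hu hv (k+1) j)

/-- Values on the four classes of blocks. -/
def kap (q1 q2 q3 q4 : ℝ) (b a : ℕ) : ℝ :=
  match a with
  | 0 => match b with
    | 0 => q2
    | _ + 1 => q1
  | 1 => q3
  | _ + 2 => q4

lemma Adm.of_bdd {f : ℕ → ℝ} (c : ℝ) (h : ∀ k, |f k| ≤ c) : Adm f :=
  Adm.mk' c 0 fun k => by simpa using h k

lemma geoS_bdd {f : ℕ → ℝ} (c : ℝ) (h : ∀ k, |f k| ≤ c) : |geoS f| ≤ c := by
  have := geoS_abs_le (f := f) (c := c) (d := 0) fun k => by simpa using h k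
  simpa using this

lemma kap_bdd (q1 q2 q3 q4 : ℝ) (b a : ℕ) :
    |kap q1 q2 q3 q4 b a| ≤ |q1| + |q2| + |q3| + |q4| := by
  have := abs_nonneg q1
  have := abs_nonneg q2
  have := abs_nonneg q3
  have := abs_nonneg q4
  unfold kap
  split
  · split <;> linarith
  · linarith
  · linarith

lemma geoS_kap (q1 q2 q3 q4 : ℝ) :
    (geoS fun b => geoS fun a => kap q1 q2 q3 q4 b a) = 1/4 * (q1 + q2 + q3 + q4) := by
  have h : ∀ b, (geoS fun a => kap q1 q2 q3 q4 b a) =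
      1/2 * kap q1 q2 q3 q4 b 0 + 1/2 * (1/2 * q3 + 1/2 * q4) := by
    intro b
    have h1 : Adm fun a => kap q1 q2 q3 q4 b a := Adm.of_bdd _ (kap_bdd q1 q2 q3 q4 b)
    rw [geoS_succ h1, geoS_succ h1.succ]
    simp only [kap]
    rw [geoS_const]
  rw [geoS_succ (Adm.of_bdd _ fun b => geoS_bdd _ (kap_bdd q1 q2 q3 q4 b))]
  simp only [h]
  simp only [kap]
  rw [geoS_const]
  ring

lemma block_main {α β σ C lam B1 B2 B3 : ℝ} {g : ℝ → ℝ → ℝ} {ρ : ℕ → ℕ → ℝ → ℝ} {R : ℕ → ℕ → ℝ}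
    (hα : 1 ≤ α) (hβ : 1 ≤ β) (hg : Close α σ C g)
    (hρ : ∀ u v, ConeA α u v → ∀ a b : ℕ,
      g (u + (b + 1 : ℕ) * β * v) (v + (a + 1) * α * (u + (b + 1 : ℕ) * β * v)) =
        g u v + ρ a b (u / v))
    (hanti : ∀ a b r s, 0 ≤ r → r ≤ s → s ≤ 1 / α → ρ a b s ≤ ρ a b r)
    (hB1 : 0 ≤ B1) (hB2 : 0 ≤ B2) (hB3 : 0 ≤ B3)
    (hRb : ∀ a b : ℕ, |R a b| ≤ B1 + B2 * a + B3 * b)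
    (hR : ∀ a b, R a b ≤ 1/4 * (ρ a b (1 / α) + ρ a b ((1 + α * β) / (α * (2 + α * β))) +
      ρ a b (1 / (2 * α)) + ρ a b (1 / (3 * α))))
    (hlam : Tendsto (fun N : ℕ => ((N : ℝ))⁻¹ * lavg α β N 0 1) atTop (nhds lam)) :
    (geoS fun a => geoS fun b => R a b) ≤ 4 * (σ * lam) := by
  have hα0 : 0 < α := by linarith
  have hβ0 : 0 < β := by linarith
  have hc1 : ∀ r, 0 ≤ r → r ≤ 1 / α → ConeA α r 1 := by
    intro r h0 h1
    refine ⟨h0, one_pos, ?_⟩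
    rwa [le_div_iff₀ hα0, mul_comm] at h1
  -- summability facts for `ρ`
  have aρ1 : ∀ r, 0 ≤ r → r ≤ 1 / α → ∀ b, Adm fun a => ρ a b r := by
    intro r h0 h1 b
    have h2 := (hg.adm_AB hα0.le hβ0.le h0 one_pos (b+1)).sub (Adm.const (g r 1))
    convert h2 using 2 with a
    have := hρ r 1 (hc1 r h0 h1) a b
    rw [div_one] at this
    rw [this]; ring
  have aρ2 : ∀ r, 0 ≤ r → r ≤ 1 / α → Adm fun b => geoS fun a => ρ a b r := by
    intro r h0 h1
    have h2 := (hg.adm_AB2 hα0.le hβ0.le h0 one_pos).succ.sub (Adm.const (g r 1))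
    convert h2 using 2 with b
    rw [← geoS_const (g r 1), ← geoS_sub (hg.adm_AB hα0.le hβ0.le h0 one_pos (b+1)) (Adm.const _)]
    congr 1; funext a
    have := hρ r 1 (hc1 r h0 h1) a b
    rw [div_one] at this
    rw [this]; ring
  set Q : ℝ → ℝ := fun r => geoS fun b => geoS fun a => ρ a b r with hQ
  have hDQ : ∀ u v, ConeA α u v → blockE α β g u v = g u v + Q (u / v) := by
    intro u v h
    have hr0 : 0 ≤ u / v := div_nonneg h.1 h.2.1.le
    have hr1 : u / v ≤ 1 / α := by
      rw [div_le_div_iff₀ h.2.1 hα0]; linarith [h.2.2]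
    unfold blockE
    simp only [hρ u v h]
    rw [hQ]
    simp only
    rw [← geoS_const (g u v), ← geoS_add (Adm.const _) (aρ2 _ hr0 hr1)]
    congr 1; funext b
    rw [geoS_add (Adm.const _) (aρ1 _ hr0 hr1 b)]
    simp only [geoS_const]
  have hQanti : ∀ r s, 0 ≤ r → r ≤ s → s ≤ 1 / α → Q s ≤ Q r := by
    intro r s h0 h1 h2
    refine geoS_mono (aρ2 s (h0.trans h1) h2) (aρ2 r h0 (h1.trans h2)) fun b => ?_
    exact geoS_mono (aρ1 s (h0.trans h1) h2 b) (aρ1 r h0 (h1.trans h2) b) fun a =>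
      hanti a b r s h0 h1 h2
  have hD := hg.blockE hα0.le hβ0.le
  have hq : Close α 0 (C + 2 * |σ| * α + 2 * |σ| * β + C) (fun u v => Q (u / v)) := by
    intro u v h
    have h1 := abs_le.1 (hD u v h)
    have h2 := abs_le.1 (hg u v h)
    have h3 := hDQ u v h
    rw [abs_le]
    constructor <;> linarith [h1.1, h1.2, h2.1, h2.2]
  rw [geoS_comm hB1 hB2 hB3 hRb]
  set c2 := (1 + α * β) / (α * (2 + α * β)) with hc2
  have hc2le : c2 ≤ 1 / α := by
    rw [hc2, div_le_div_iff₀ (by positivity) (by positivity)]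
    nlinarith [mul_pos hα0 hβ0]
  have hs2le : 1 / (2 * α) ≤ 1 / α := by
    rw [div_le_div_iff₀ (by positivity) (by positivity)]; linarith
  have hs3le : 1 / (3 * α) ≤ 1 / α := by
    rw [div_le_div_iff₀ (by positivity) (by positivity)]; linarith
  have p1 : 0 ≤ 1 / α := by positivity
  have p2 : 0 ≤ c2 := by positivity
  have p3 : 0 ≤ 1 / (2 * α) := by positivity
  have p4 : 0 ≤ 1 / (3 * α) := by positivity
  have hRQ : (geoS fun b => geoS fun a => R a b) ≤
      1/4 * (Q (1 / α) + Q c2 + Q (1 / (2 * α)) + Q (1 / (3 * α))) := by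
    have e1 : ∀ b, Adm fun a => 1/4 * (ρ a b (1 / α) + ρ a b c2 + ρ a b (1 / (2 * α)) +
        ρ a b (1 / (3 * α))) := fun b =>
      ((((aρ1 _ p1 le_rfl b).add (aρ1 _ p2 hc2le b)).add (aρ1 _ p3 hs2le b)).add
        (aρ1 _ p4 hs3le b)).smul _
    have e2 : ∀ b, (geoS fun a => 1/4 * (ρ a b (1 / α) + ρ a b c2 + ρ a b (1 / (2 * α)) +
        ρ a b (1 / (3 * α)))) = 1/4 * ((geoS fun a => ρ a b (1 / α)) + (geoS fun a => ρ a b c2) +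
        (geoS fun a => ρ a b (1 / (2 * α))) + (geoS fun a => ρ a b (1 / (3 * α)))) := by
      intro b
      rw [geoS_smul, geoS_add (((aρ1 _ p1 le_rfl b).add (aρ1 _ p2 hc2le b)).add (aρ1 _ p3 hs2le b))
        (aρ1 _ p4 hs3le b), geoS_add ((aρ1 _ p1 le_rfl b).add (aρ1 _ p2 hc2le b))
        (aρ1 _ p3 hs2le b), geoS_add (aρ1 _ p1 le_rfl b) (aρ1 _ p2 hc2le b)]
    have e3 : (geoS fun b => geoS fun a => 1/4 * (ρ a b (1 / α) + ρ a b c2 + ρ a b (1 / (2 * α)) +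
        ρ a b (1 / (3 * α)))) = 1/4 * (Q (1 / α) + Q c2 + Q (1 / (2 * α)) + Q (1 / (3 * α))) := by
      simp only [e2]
      rw [geoS_smul, geoS_add (((aρ2 _ p1 le_rfl).add (aρ2 _ p2 hc2le)).add (aρ2 _ p3 hs2le))
        (aρ2 _ p4 hs3le), geoS_add ((aρ2 _ p1 le_rfl).add (aρ2 _ p2 hc2le))
        (aρ2 _ p3 hs2le), geoS_add (aρ2 _ p1 le_rfl) (aρ2 _ p2 hc2le)]
    rw [← e3]
    have r1 : ∀ b, ∀ a : ℕ, |R a b| ≤ (B1 + B3 * b) + B2 * a := fun b a => by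
      have := hRb a b
      linarith
    refine geoS_mono (Adm.mk' (B1 + B2) B3 fun b => ?_) ?_ fun b => ?_
    · have := geoS_abs_le (r1 b)
      linarith
    · simp only [e2]
      exact ((((aρ2 _ p1 le_rfl).add (aρ2 _ p2 hc2le)).add (aρ2 _ p3 hs2le)).add
        (aρ2 _ p4 hs3le)).smul _
    · exact geoS_mono (Adm.mk' _ _ (r1 b)) (e1 b) fun a => hR a b
  refine dyn_limit (D := blockE α β g) hα0.le hβ0.le hD ?_ hlam
  intro u v h
  have hu := h.1
  have hv := h.2.1
  rw [blockE_congr (g := blockE α β g) hα0.le hβ0.le hDQ hu hv,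
    blockE_add hα0.le hβ0.le hg hq hu hv]
  refine add_le_add_right (hRQ.trans ?_) _
  rw [← geoS_kap]
  refine geoS_mono (Adm.of_bdd _ fun b => geoS_bdd _ (kap_bdd _ _ _ _ b))
    (hq.adm_AB2 hα0.le hβ0.le hu hv).succ fun b => ?_
  refine geoS_mono (Adm.of_bdd _ (kap_bdd _ _ _ _ b)) (hq.adm_AB hα0.le hβ0.le hu hv (b+1))
    fun a => ?_
  have hu' : 0 < u + (b + 1 : ℕ) * β * v := by positivity
  have hb : ∀ m : ℝ, 0 < m → m ≤ a + 1 →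
      (u + (b + 1 : ℕ) * β * v) / (v + (a + 1) * α * (u + (b + 1 : ℕ) * β * v)) ≤ 1 / (m * α) := by
    intro m hm hma
    rw [div_le_div_iff₀ (by positivity) (by positivity)]
    have := mul_le_mul_of_nonneg_right hma (by positivity : 0 ≤ α * (u + (b + 1 : ℕ) * β * v))
    linarith
  have hr0 : 0 ≤ (u + (b + 1 : ℕ) * β * v) / (v + (a + 1) * α * (u + (b + 1 : ℕ) * β * v)) := by
    positivity
  match a, b with
  | 0, 0 =>
    simp only [kap]
    refine hQanti _ _ hr0 ?_ hc2le
    rw [hc2, div_le_div_iff₀ (by positivity) (by positivity)]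
    push_cast
    have := h.2.2
    nlinarith
  | 0, b + 1 =>
    simp only [kap]
    refine hQanti _ _ hr0 ?_ le_rfl
    have := hb 1 one_pos (by push_cast; linarith)
    rwa [one_mul] at this
  | 1, b =>
    simp only [kap]
    exact hQanti _ _ hr0 (hb 2 two_pos (by push_cast; linarith)) hs2le
  | a + 2, b =>
    simp only [kap]
    refine hQanti _ _ hr0 (hb 3 three_pos (by push_cast; have : (0:ℝ) ≤ a := by positivity
                                              linarith)) hs3le

lemma lower_alg {α x : ℝ} (hα : 1 ≤ α) (hx : α ≤ x) :
    (α / (1 + α) + α * (x + 2) / (α * (x + 2) + x + 1) +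
      α * (2 * x + 3) / (α * (2 * x + 3) + x + 1)) / 3 *
      ((1 + 1 / α) + (1 + (1 + x) / (α * (2 + x))) + (1 + 1 / (2 * α)) + (1 + 1 / (3 * α))) ≤ 4 := by
  obtain ⟨p, rfl⟩ : ∃ p, α = 1 + p := ⟨α - 1, by ring⟩
  obtain ⟨w, rfl⟩ : ∃ w, x = 1 + p + w := ⟨x - (1 + p), by ring⟩
  have hp : 0 ≤ p := by linarith
  have hw : 0 ≤ w := by linarith
  rw [← sub_nonneg]
  have d1 : (1 + (1 + p)) ≠ 0 := by positivity
  have d2 : ((1 + p) * (1 + p + w + 2) + (1 + p + w) + 1) ≠ 0 := by positivity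
  have d3 : ((1 + p) * (2 * (1 + p + w) + 3) + (1 + p + w) + 1) ≠ 0 := by positivity
  have d4 : 1 + p ≠ 0 := by positivity
  have d5 : 2 + (1 + p + w) ≠ 0 := by positivity
  field_simp
  ring_nf
  positivity

lemma log_tangent {m x : ℝ} (hm : 0 < m) (hx : 0 < x) :
    Real.log m + 1 - m / x ≤ Real.log x := by
  have := Real.log_le_sub_one_of_pos (div_pos hm hx)
  rw [Real.log_div hm.ne' hx.ne'] at this
  linarith

lemma lower_term {U D k kb : ℝ} (hU : 0 < U) (hD : 0 ≤ D) (hk : 0 < k) (hkb : 0 < kb) :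
    (U + D * kb) / (U + D * k) - 1 ≤ D / (U / kb + D) * (kb * (1 / k) - 1) := by
  rw [← sub_nonneg]
  have h1 : 0 < U + D * k := by positivity
  have h2 : 0 < U + D * kb := by positivity
  have e : D / (U / kb + D) * (kb * (1 / k) - 1) - ((U + D * kb) / (U + D * k) - 1) =
      D * U * (kb - k) ^ 2 / (k * (U + D * k) * (U + D * kb)) := by
    have h3 : D / (U / kb + D) = D * kb / (U + D * kb) := by
      field_simp
    rw [h3]
    field_simp
    ring
  rw [e]
  positivity

lemma upper_alg {α x : ℝ} (hα : 1 ≤ α) (hx : α ≤ x) :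
    1 / 4 * (1 / α + (1 + x) / (α * (2 + x)) + 1 / (2 * α) + 1 / (3 * α)) ≤
    1 / 3 * (1 / α + (1 + x) / (α * (2 + x)) + (1 + x) / (α * (3 + 2 * x))) := by
  obtain ⟨p, rfl⟩ : ∃ p, α = 1 + p := ⟨α - 1, by ring⟩
  obtain ⟨w, rfl⟩ : ∃ w, x = 1 + p + w := ⟨x - (1 + p), by ring⟩
  have hp : 0 ≤ p := by linarith
  have hw : 0 ≤ w := by linarith
  rw [← sub_nonneg]
  have d3 : (3 + 2 * (1 + p + w)) ≠ 0 := by positivity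
  have d4 : 1 + p ≠ 0 := by positivity
  have d5 : 2 + (1 + p + w) ≠ 0 := by positivity
  field_simp
  ring_nf
  positivity

lemma log_growth {A B y : ℝ} (hA : 0 ≤ A) (hB : 0 ≤ B) (h1 : 1 ≤ y) (h2 : y ≤ (1 + A) * (1 + B)) :
    |Real.log y| ≤ A + B := by
  rw [abs_of_nonneg (Real.log_nonneg h1)]
  have h3 := Real.log_le_log (by linarith) h2
  rw [Real.log_mul (by positivity) (by positivity)] at h3
  have h4 := Real.log_le_sub_one_of_pos (by linarith : 0 < 1 + A)
  have h5 := Real.log_le_sub_one_of_pos (by linarith : 0 < 1 + B)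
  linarith

lemma lower_bound {α β lam : ℝ} (hα : 1 ≤ α) (hβ : 1 ≤ β)
    (hlam : Tendsto (fun N : ℕ => ((N : ℝ))⁻¹ * lavg α β N 0 1) atTop (nhds lam)) :
    (geoS fun a => geoS fun b =>
        Real.log ((1 / 3) * (phihat11 α β (a + 1) (b + 1) + phihat12 α β (a + 1) (b + 1) +
          phihat13 α β (a + 1) (b + 1)))) ≤ 4 * lam := by
  have hα0 : 0 < α := by linarith
  have hβ0 : 0 < β := by linarith
  have hx : α ≤ α * β := by nlinarith
  have hx0 : 0 < α * β := by positivity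
  set kb := (α / (1 + α) + α * (α * β + 2) / (α * (α * β + 2) + α * β + 1) +
      α * (2 * (α * β) + 3) / (α * (2 * (α * β) + 3) + α * β + 1)) / 3 with hkb
  have hkb0 : 0 < kb := by positivity
  have hkb1 : kb ≤ 1 := by
    have h1 : α / (1 + α) ≤ 1 := by rw [div_le_one (by positivity)]; linarith
    have h2 : α * (α * β + 2) / (α * (α * β + 2) + α * β + 1) ≤ 1 := by
      rw [div_le_one (by positivity)]; linarith
    have h3 : α * (2 * (α * β) + 3) / (α * (2 * (α * β) + 3) + α * β + 1) ≤ 1 := by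
      rw [div_le_one (by positivity)]; linarith
    rw [hkb]; linarith
  have hphi : ∀ a b : ℕ, (1 / 3) * (phihat11 α β (a + 1) (b + 1) + phihat12 α β (a + 1) (b + 1) +
          phihat13 α β (a + 1) (b + 1)) =
      (1 + (a + 1) * α) + ((b + 1) * β + (a + 1) * α * ((b + 1) * β - 1)) * kb := by
    intro a b
    unfold phihat11 phihat12 phihat13
    rw [hkb]
    have d2 : α * (α * β + β + 2) + 1 = α * (α * β + 2) + α * β + 1 := by ring
    have d3 : α * (2 * (α * β) + β + 3) + 1 = α * (2 * (α * β) + 3) + α * β + 1 := by ring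
    rw [d2, d3]
    have e2 : α * (α * β + 2) + α * β + 1 ≠ 0 := by positivity
    have e3 : α * (2 * (α * β) + 3) + α * β + 1 ≠ 0 := by positivity
    push_cast
    have f1 : 1 + α / (1 + α) * (((a:ℝ) + 1) + (b + 1) * β + (a + 1) * α * ((b + 1) * β)) =
      (1 + (a + 1) * α) + ((b + 1) * β + (a + 1) * α * ((b + 1) * β - 1)) * (α / (1 + α)) := by
      field_simp
      ring
    have f2 : (α * (α * β + 2) * (((a:ℝ) + 1) * α * ((b + 1) * β) + (b + 1) * β + 1) +
        ((a + 1) * α + 1) * (α * β + 1)) / (α * (α * β + 2) + α * β + 1) =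
      (1 + (a + 1) * α) + ((b + 1) * β + (a + 1) * α * ((b + 1) * β - 1)) *
        (α * (α * β + 2) / (α * (α * β + 2) + α * β + 1)) := by
      rw [div_eq_iff e2, add_mul (1 + ((a:ℝ) + 1) * α), mul_assoc _ (α * (α * β + 2) / _), div_mul_cancel₀ _ e2]
      ring
    have f3 : (α * (2 * (α * β) + 3) * (((a:ℝ) + 1) * α * ((b + 1) * β) + (b + 1) * β + 1) +
        ((a + 1) * α + 1) * (α * β + 1)) / (α * (2 * (α * β) + 3) + α * β + 1) =
      (1 + (a + 1) * α) + ((b + 1) * β + (a + 1) * α * ((b + 1) * β - 1)) *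
        (α * (2 * (α * β) + 3) / (α * (2 * (α * β) + 3) + α * β + 1)) := by
      rw [div_eq_iff e3, add_mul (1 + ((a:ℝ) + 1) * α), mul_assoc _ (α * (2 * (α * β) + 3) / _), div_mul_cancel₀ _ e3]
      ring
    rw [f1, f2, f3]
    ring
  have hDpos : ∀ a b : ℕ, 0 ≤ ((b:ℝ) + 1) * β + (a + 1) * α * ((b + 1) * β - 1) := by
    intro a b
    have : 0 ≤ ((b:ℝ) + 1) * β - 1 := by
      have : (0:ℝ) ≤ b * β := by positivity
      linarith
    positivity
  simp only [hphi]
  have := block_main (σ := 1) (C := 0) (lam := lam) (B1 := α + β) (B2 := α) (B3 := β)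
    (g := fun u v => Real.log (u + v))
    (ρ := fun a b r => Real.log ((1 + (a + 1) * α) +
      ((b + 1) * β + (a + 1) * α * ((b + 1) * β - 1)) * (1 / (1 + r))))
    (R := fun a b => Real.log ((1 + (a + 1) * α) +
      ((b + 1) * β + (a + 1) * α * ((b + 1) * β - 1)) * kb))
    hα hβ (fun u v _ => by simp) ?_ ?_ (by positivity) (by positivity) (by positivity) ?_ ?_ hlam
  · simpa using this
  · intro u v h a b
    obtain ⟨hu, hv, -⟩ := h
    have hD := hDpos a b
    have hs : 0 < u + v := by positivity
    have hk : 0 < 1 / (1 + u / v) := by positivity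
    rw [← Real.log_mul hs.ne' (by positivity)]
    congr 1
    have : 1 / (1 + u / v) = v / (u + v) := by field_simp; ring
    rw [this]
    field_simp
    push_cast
    ring
  · intro a b r s h0 hrs _
    have hD := hDpos a b
    have : 0 < 1 / (1 + s) := by have : 0 ≤ s := h0.trans hrs
                                 positivity
    apply Real.log_le_log (by positivity)
    gcongr
  · intro a b
    have hD := hDpos a b
    have := log_growth (A := (a + 1) * α) (B := (b + 1) * β) (by positivity) (by positivity)
      (y := (1 + (a + 1) * α) + ((b + 1) * β + (a + 1) * α * ((b + 1) * β - 1)) * kb)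
      (by have : 0 ≤ (((b:ℝ) + 1) * β + (a + 1) * α * ((b + 1) * β - 1)) * kb := by positivity
          have : 0 ≤ ((a:ℝ) + 1) * α := by positivity
          linarith)
      (by have := mul_le_mul_of_nonneg_left hkb1 hD
          have : 0 ≤ ((a:ℝ) + 1) * α := by positivity
          linarith)
    linarith
  · intro a b
    have hD := hDpos a b
    set U := 1 + ((a:ℝ) + 1) * α with hU
    have hU0 : 0 < U := by positivity
    set D := ((b:ℝ) + 1) * β + (a + 1) * α * ((b + 1) * β - 1)
    have hm : 0 < U + D * kb := by positivity
    have key : ∀ r : ℝ, 0 ≤ r → Real.log (U + D * kb) - D / (U / kb + D) * (kb * (1 + r) - 1) ≤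
        Real.log (U + D * (1 / (1 + r))) := by
      intro r hr
      have hk : 0 < 1 / (1 + r) := by positivity
      have h1 := log_tangent hm (by positivity : 0 < U + D * (1 / (1 + r)))
      have h2 := lower_term hU0 hD hk hkb0
      rw [one_div_one_div] at h2
      linarith
    have k1 := key (1 / α) (by positivity)
    have k2 := key ((1 + α * β) / (α * (2 + α * β))) (by positivity)
    have k3 := key (1 / (2 * α)) (by positivity)
    have k4 := key (1 / (3 * α)) (by positivity)
    have hal := lower_alg hα hx
    rw [← hkb] at hal
    have := mul_le_mul_of_nonneg_left hal (by positivity : 0 ≤ D / (U / kb + D))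
    linarith

lemma upper_bound {α β lam : ℝ} (hα : 1 ≤ α) (hβ : 1 ≤ β)
    (hlam : Tendsto (fun N : ℕ => ((N : ℝ))⁻¹ * lavg α β N 0 1) atTop (nhds lam)) :
    4 * lam ≤ (geoS fun a => geoS fun b =>
        Real.log ((1 / 3) * (psihatInf1 α β (a + 1) (b + 1) + psihatInf2 α β (a + 1) (b + 1) +
          psihatInf3 α β (a + 1) (b + 1)))) := by
  have hα0 : 0 < α := by linarith
  have hβ0 : 0 < β := by linarith
  have hx : α ≤ α * β := by nlinarith
  have hx0 : 0 < α * β := by positivity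
  set rb := 1 / 3 * (1 / α + (1 + α * β) / (α * (2 + α * β)) +
    (1 + α * β) / (α * (3 + 2 * (α * β)))) with hrb
  have hrb0 : 0 < rb := by positivity
  have hrb1 : rb ≤ 1 := by
    have h1 : 1 / α ≤ 1 := by rw [div_le_one (by positivity)]; linarith
    have h2 : (1 + α * β) / (α * (2 + α * β)) ≤ 1 := by
      rw [div_le_one (by positivity)]; nlinarith
    have h3 : (1 + α * β) / (α * (3 + 2 * (α * β))) ≤ 1 := by
      rw [div_le_one (by positivity)]; nlinarith
    rw [hrb]; linarith
  have hpsi : ∀ a b : ℕ, (1 / 3) * (psihatInf1 α β (a + 1) (b + 1) +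
      psihatInf2 α β (a + 1) (b + 1) + psihatInf3 α β (a + 1) (b + 1)) =
      1 + (a + 1) * α * ((b + 1) * β) + (a + 1) * α * rb := by
    intro a b
    unfold psihatInf1 psihatInf2 psihatInf3
    rw [hrb]
    push_cast
    field_simp
    ring
  simp only [hpsi]
  have := block_main (σ := -1) (C := Real.log 2) (lam := lam) (B1 := α + β) (B2 := α) (B3 := β)
    (g := fun u v => - Real.log v)
    (ρ := fun a b r => - Real.log (1 + (a + 1) * α * ((b + 1) * β) + (a + 1) * α * r))
    (R := fun a b => (-1) * Real.log (1 + (a + 1) * α * ((b + 1) * β) + (a + 1) * α * rb))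
    hα hβ ?_ ?_ ?_ (by positivity) (by positivity) (by positivity) ?_ ?_ hlam
  · simp only [geoS_smul] at this
    linarith
  · intro u v h
    obtain ⟨hu, hv, h⟩ := h
    have h1 := Real.log_le_log hv (by linarith : v ≤ u + v)
    have h2 := Real.log_le_log (by linarith : 0 < u + v) (by nlinarith : u + v ≤ 2 * v)
    rw [Real.log_mul (by norm_num) hv.ne'] at h2
    have := Real.log_nonneg (by norm_num : (1:ℝ) ≤ 2)
    rw [abs_le]
    constructor <;> linarith
  · intro u v h a b
    obtain ⟨hu, hv, -⟩ := h
    rw [← neg_add, ← Real.log_mul hv.ne' (by positivity)]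
    congr 2
    field_simp
    push_cast
    ring
  · intro a b r s h0 hrs _
    apply neg_le_neg
    apply Real.log_le_log (by positivity)
    gcongr
  · intro a b
    rw [neg_one_mul, abs_neg]
    have := log_growth (A := (a + 1) * α) (B := (b + 1) * β) (by positivity) (by positivity)
      (y := 1 + (a + 1) * α * ((b + 1) * β) + (a + 1) * α * rb)
      (by have : 0 ≤ ((a:ℝ) + 1) * α * ((b + 1) * β) + (a + 1) * α * rb := by positivity
          linarith)
      (by have := mul_le_mul_of_nonneg_left hrb1 (by positivity : 0 ≤ ((a:ℝ) + 1) * α)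
          have : 0 ≤ ((b:ℝ) + 1) * β := by positivity
          linarith)
    linarith
  · intro a b
    set P := 1 + ((a:ℝ) + 1) * α * ((b + 1) * β)
    set A := ((a:ℝ) + 1) * α
    have hA : 0 ≤ A := by positivity
    have hP : 0 < P := by positivity
    have hm : 0 < P + A * rb := by positivity
    have key : ∀ r : ℝ, 0 ≤ r → Real.log (P + A * r) ≤
        Real.log (P + A * rb) + A / (P + A * rb) * (r - rb) := by
      intro r hr
      have hr' : 0 < P + A * r := by positivity
      have := Real.log_le_sub_one_of_pos (div_pos hr' hm)
      rw [Real.log_div hr'.ne' hm.ne'] at this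
      have e : (P + A * r) / (P + A * rb) - 1 = A / (P + A * rb) * (r - rb) := by
        field_simp
        ring
      linarith
    have k1 := key (1 / α) (by positivity)
    have k2 := key ((1 + α * β) / (α * (2 + α * β))) (by positivity)
    have k3 := key (1 / (2 * α)) (by positivity)
    have k4 := key (1 / (3 * α)) (by positivity)
    have hal := upper_alg hα hx
    rw [← hrb] at hal
    have := mul_le_mul_of_nonneg_left hal (by positivity : 0 ≤ A / (P + A * rb))
    linarith

theorem improved_cone_bounds (α β lam : ℝ) (hα : 1 ≤ α) (hβ : 1 ≤ β)
    (hlam : Tendsto (fun N : ℕ =>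
        ((N : ℝ))⁻¹ * ((2 : ℝ) ^ N)⁻¹ *
          ∑ i : Fin N → Fin 2,
            Real.log (nrm2 ((wordProd !![1, 0; α, 1] !![1, β; 0, 1] N i).mulVec ![0, 1])))
      atTop (nhds lam)) :
    (∑' (a : ℕ) (b : ℕ), ((2 : ℝ) ^ (a + b + 2))⁻¹ *
        Real.log ((1 / 3) * (phihat11 α β (a + 1) (b + 1) + phihat12 α β (a + 1) (b + 1) +
          phihat13 α β (a + 1) (b + 1)))) ≤ 4 * lam ∧
      4 * lam ≤ ∑' (a : ℕ) (b : ℕ), ((2 : ℝ) ^ (a + b + 2))⁻¹ *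
        Real.log ((1 / 3) * (psihatInf1 α β (a + 1) (b + 1) + psihatInf2 α β (a + 1) (b + 1) +
          psihatInf3 α β (a + 1) (b + 1))) := by
  have hlam' : Tendsto (fun N : ℕ => ((N : ℝ))⁻¹ * lavg α β N 0 1) atTop (nhds lam) := by
    refine hlam.congr fun N => ?_
    rw [mul_assoc]
    rfl
  rw [geoS_stmt, geoS_stmt]
  exact ⟨lower_bound hα hβ hlam', upper_bound hα hβ hlam'⟩

end
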